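/- Let (λ_n)_{n≥1} ⊂ D be a sequence with Σ_{n≥1}(1 − |λ_n|) = ∞ and let f ∈ H(b). If the closed linear span in H(b) of {f·k_{λ_n} : n ≥ 1} equals H(b), then f is an outer function. -/

import Mathlib

open MeasureTheory Complex Filter Set Metric
open scoped ComplexConjugate

noncomputable section

/-- The circle group `ℝ / 2πℤ`, parametrizing the unit circle `𝕋`. -/
instance fact_two_pi_pos : Fact (0 < 2 * Real.pi) := ⟨by positivity⟩

abbrev Tc : Type := AddCircle (2 * Real.pi)

/-- Normalized Lebesgue measure on the circle. -/
def m : Measure Tc := AddCircle.haarAddCircle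

instance : IsProbabilityMeasure m := by unfold m; infer_instance

/-- The point `e^{iθ}` of the unit circle corresponding to `θ ∈ ℝ/2πℤ`. -/
def bd (θ : Tc) : ℂ := (AddCircle.toCircle θ : ℂ)

/-- The open unit disc. -/
abbrev uDisc : Set ℂ := Metric.ball (0 : ℂ) 1

/-- A function holomorphic on the open unit disc. -/
def HolDisc (f : ℂ → ℂ) : Prop := DifferentiableOn ℂ f uDisc

/-- `F` is the radial (a.e.) boundary function of `f`. -/
def IsBdry (f : ℂ → ℂ) (F : Tc → ℂ) : Prop :=
  ∀ᵐ θ ∂m, Tendsto (fun r : ℝ => f ((r : ℂ) * bd θ)) (nhdsWithin 1 (Set.Iio 1)) (nhds (F θ))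

/-- Membership in the Hardy space `H^p` of the unit disc, `0 < p < ∞`. -/
def MemHp (p : ℝ) (f : ℂ → ℂ) : Prop :=
  HolDisc f ∧ ∃ C : ℝ, ∀ r : ℝ, 0 ≤ r → r < 1 →
    (∫ θ : Tc, ‖f ((r : ℂ) * bd θ)‖ ^ p ∂m) ≤ C

/-- Membership in `H^∞`: bounded holomorphic functions on the disc. -/
def MemHinf (f : ℂ → ℂ) : Prop := HolDisc f ∧ ∃ C : ℝ, ∀ z ∈ uDisc, ‖f z‖ ≤ C

/-- Outer functions on the unit disc. -/
def OuterFn (f : ℂ → ℂ) : Prop :=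
  HolDisc f ∧ ∃ (α : ℂ) (w : Tc → ℝ), ‖α‖ = 1 ∧ (∀ θ, 0 ≤ w θ) ∧
    Integrable (fun θ => Real.log (w θ)) m ∧
    ∀ z ∈ uDisc,
      f z = α * Complex.exp (∫ θ : Tc, ((bd θ + z) / (bd θ - z)) * (Real.log (w θ) : ℂ) ∂m)

/-- Inner functions: `Θ` holomorphic bounded by one, with unimodular boundary values `Θs`. -/
def InnerFn (Θ : ℂ → ℂ) (Θs : Tc → ℂ) : Prop :=
  HolDisc Θ ∧ (∀ z ∈ uDisc, ‖Θ z‖ ≤ 1) ∧ IsBdry Θ Θs ∧ (∀ᵐ θ ∂m, ‖Θs θ‖ = 1)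

/-- `L²(𝕋, m)`. -/
abbrev L2 : Type := Lp ℂ 2 m

/-- The Hardy space `H²`, viewed inside `L²(𝕋)` as the functions whose negative
Fourier coefficients vanish. -/
def H2 : Set L2 := {F | ∀ n : ℤ, n < 0 → fourierCoeff (F : Tc → ℂ) n = 0}

/-- The Cauchy kernel `k_λ(z) = 1/(1 - conj(λ) z)`. -/
def ker (lam z : ℂ) : ℂ := (1 - conj lam * z)⁻¹

/-- Divergence of `Σ (1 - |λ_n|)` (for `λ_n` in the unit disc this is the negation of
the Blaschke condition). -/
def NotBlaschke (lam : ℕ → ℂ) : Prop := ¬ Summable (fun n => 1 - ‖lam n‖)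

/-- A bundle recording: a non-constant function `b` in the closed unit ball of `H^∞`
with `log(1 - |b|) ∈ L¹(𝕋)`, its Pythagorean mate `a` (outer, `a(0) > 0`,
`|a|² + |b|² = 1` a.e.), together with their boundary functions `bs`, `as'`. -/
structure BPair where
  b : ℂ → ℂ
  a : ℂ → ℂ
  bs : Tc → ℂ
  as' : Tc → ℂ
  b_hol : HolDisc b
  b_le_one : ∀ z ∈ uDisc, ‖b z‖ ≤ 1
  b_nonconst : ¬ ∃ c : ℂ, ∀ z ∈ uDisc, b z = c
  b_bdry : IsBdry b bs
  log_int : Integrable (fun θ => Real.log (1 - ‖bs θ‖)) m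
  a_outer : OuterFn a
  a_bdry : IsBdry a as'
  a0_pos : ∃ r : ℝ, 0 < r ∧ a 0 = (r : ℂ)
  pyth : ∀ᵐ θ ∂m, ‖as' θ‖ ^ 2 + ‖bs θ‖ ^ 2 = 1

/-- The defining relation of `H(b)`: `T_{conj b} F = T_{conj a} F⁺`, i.e. all nonnegative
Fourier coefficients of `conj(b)·F - conj(a)·F⁺` vanish, with `F, F⁺ ∈ H²`. -/
def HbMem (P : BPair) (F Fp : L2) : Prop :=
  F ∈ H2 ∧ Fp ∈ H2 ∧ ∀ n : ℤ, 0 ≤ n →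
    fourierCoeff (fun θ => conj (P.bs θ) * (F : Tc → ℂ) θ - conj (P.as' θ) * (Fp : Tc → ℂ) θ) n = 0

/-- The ambient Hilbert space `L² ×_2 L²` in which `H(b)` embeds isometrically via
`f ↦ (f, f⁺)`; its norm is `‖(F, F⁺)‖² = ‖F‖₂² + ‖F⁺‖₂²`, the `H(b)` norm. -/
abbrev HbP : Type := WithLp 2 (L2 × L2)

def fst2 (p : HbP) : L2 := ((WithLp.equiv 2 (L2 × L2)) p).1
def snd2 (p : HbP) : L2 := ((WithLp.equiv 2 (L2 × L2)) p).2

/-- The de Branges–Rovnyak space `H(b)`, as the set of pairs `(f, f⁺)`. -/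
def HbSet (P : BPair) : Set HbP := {p | HbMem P (fst2 p) (snd2 p)}

/-- `q` represents the element `φ · f` of `H(b)`, where `p` represents `f` and `φs` is a
boundary function: `q ∈ H(b)` and the first component of `q` is `φs` times that of `p`. -/
def MulRep (P : BPair) (φs : Tc → ℂ) (p q : HbP) : Prop :=
  q ∈ HbSet P ∧ (fst2 q : Tc → ℂ) =ᵐ[m] fun θ => φs θ * (fst2 p : Tc → ℂ) θ

/-- `Zf` is the family of elements `z^n·f`, `n ≥ 0`, of `H(b)`, where `p` represents `f`. -/
def ZFamily (P : BPair) (p : HbP) (Zf : ℕ → HbP) : Prop :=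
  ∀ n : ℕ, MulRep P (fun θ => (bd θ) ^ n) p (Zf n)

/-- `f` (represented by the pair `p`) is cyclic for `S_b`: the linear span of
`{z^n f : n ≥ 0}` is dense in `H(b)`. -/
def CyclicSb (P : BPair) (p : HbP) : Prop :=
  p ∈ HbSet P ∧ ∀ Zf : ℕ → HbP, ZFamily P p Zf →
    closure (↑(Submodule.span ℂ (Set.range Zf)) : Set HbP) = HbSet P

/-- `FK` is the family of elements `f·k_{λ_n}`, `n ≥ 0`, of `H(b)`. -/
def KFamily (P : BPair) (lam : ℕ → ℂ) (p : HbP) (FK : ℕ → HbP) : Prop :=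
  ∀ n : ℕ, MulRep P (fun θ => ker (lam n) (bd θ)) p (FK n)

/-- `C` is a bound for the norm of the shift `S_b` on `H(b)`. -/
def ShiftBound (P : BPair) (C : ℝ) : Prop :=
  0 ≤ C ∧ ∀ p q : HbP, p ∈ HbSet P → MulRep P (fun θ => bd θ) p q → ‖q‖ ≤ C * ‖p‖

/-- `N = ‖S_b‖`, the operator norm of the shift on `H(b)`. -/
def IsShiftNorm (P : BPair) (N : ℝ) : Prop :=
  ShiftBound P N ∧ ∀ C : ℝ, ShiftBound P C → N ≤ C

/-- `μ` is the Aleksandrov–Clark measure `μ_α` of `b`. -/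
def IsACMeasure (P : BPair) (α : ℂ) (μ : Measure Tc) : Prop :=
  IsFiniteMeasure μ ∧ ∀ z ∈ uDisc,
    (1 - ‖P.b z‖ ^ 2) / ‖1 - conj α * P.b z‖ ^ 2 = ∫ θ : Tc, (1 - ‖z‖ ^ 2) / ‖z - bd θ‖ ^ 2 ∂μ



lemma bd_continuous : Continuous bd := by
  unfold bd
  exact continuous_subtype_val.comp AddCircle.continuous_toCircle

lemma norm_bd (θ : Tc) : ‖bd θ‖ = 1 := Circle.norm_coe _

lemma bd_coe (x : ℝ) : bd (x : Tc) = circleMap 0 1 x := by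
  unfold bd
  rw [AddCircle.toCircle_apply_mk, Circle.coe_exp, circleMap]
  have : (2 * Real.pi) ≠ 0 := by positivity
  simp [div_self this]

lemma bd_pow (θ : Tc) (n : ℕ) : fourier (n : ℤ) θ = bd θ ^ n := by
  unfold bd
  rw [fourier_apply]
  simp [AddCircle.toCircle_nsmul]

lemma integral_bd {E : Type*} [NormedAddCommGroup E] [NormedSpace ℝ E] (g : ℂ → E) :
    ∫ θ : Tc, g (bd θ) ∂m = Real.circleAverage g 0 1 := by
  unfold m
  rw [AddCircle.integral_haarAddCircle, ← AddCircle.intervalIntegral_preimage (2 * Real.pi) 0,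
    Real.circleAverage_def]
  simp [bd_coe]

/-- Poisson kernel. -/
def Pk (z : ℂ) (θ : Tc) : ℝ := ((bd θ + z) / (bd θ - z)).re

lemma bd_sub_ne {z : ℂ} (hz : z ∈ uDisc) (θ : Tc) : bd θ - z ≠ 0 := by
  intro h
  have h1 : bd θ = z := sub_eq_zero.1 h
  have := norm_bd θ
  rw [h1] at this
  simp at hz
  linarith

lemma bd_mem (θ : Tc) : bd θ ∈ sphere (0 : ℂ) 1 := by simp [norm_bd]

lemma hk_continuous {z : ℂ} (hz : z ∈ uDisc) :
    Continuous (fun θ : Tc => (bd θ + z) / (bd θ - z)) :=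
  (bd_continuous.add continuous_const).div (bd_continuous.sub continuous_const) (bd_sub_ne hz)

lemma Pk_continuous {z : ℂ} (hz : z ∈ uDisc) : Continuous (Pk z) :=
  Complex.continuous_re.comp (hk_continuous hz)

lemma Pk_le {z : ℂ} (hz : z ∈ uDisc) (θ : Tc) : Pk z θ ≤ (1 + ‖z‖) / (1 - ‖z‖) := by
  have := re_herglotzRieszKernel_le (bd_mem θ) hz
  simpa [Pk] using this

lemma Pk_lower {z : ℂ} (hz : z ∈ uDisc) (θ : Tc) : (1 - ‖z‖) / (1 + ‖z‖) ≤ Pk z θ := by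
  have := le_re_herglotzRieszKernel (bd_mem θ) hz
  simpa [Pk] using this

lemma Pk_pos {z : ℂ} (hz : z ∈ uDisc) (θ : Tc) : 0 < Pk z θ := by
  have h := Pk_lower hz θ
  have : ‖z‖ < 1 := by simpa using hz
  have h2 : 0 < (1 - ‖z‖) / (1 + ‖z‖) := div_pos (by linarith) (by positivity)
  linarith

lemma Pk_formula (z : ℂ) (θ : Tc) : Pk z θ = (1 - ‖z‖ ^ 2) / ‖bd θ - z‖ ^ 2 := by
  have := congrFun (poissonKernel_eq_re_herglotzRieszKernel (c := 0) (w := z)) (bd θ)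
  simp only [poissonKernel, herglotzRieszKernel, Function.comp, sub_zero, norm_bd, one_pow] at this
  rw [Pk, this]

lemma Pk_symm (r : ℝ) (θ φ : Tc) : Pk (r * bd φ) θ = Pk (r * bd θ) φ := by
  rw [Pk_formula, Pk_formula]
  have h : ‖bd θ - r * bd φ‖ = ‖bd φ - r * bd θ‖ := by
    have e1 : ∀ x : Tc, bd x * conj (bd x) = 1 := by
      intro x
      rw [Complex.mul_conj, Complex.normSq_eq_norm_sq, norm_bd]; simp
    have : conj (bd θ - r * bd φ) * (bd θ * bd φ) = bd φ - r * bd θ := by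
      simp only [map_sub, map_mul, Complex.conj_ofReal]
      linear_combination (bd φ) * e1 θ - r * bd θ * e1 φ
    rw [← this, norm_mul, norm_mul, norm_bd, norm_bd, RCLike.norm_conj]; simp
  rw [h]
  simp [norm_bd]

lemma poisson_hol {S : ℂ → ℂ} (hS : DiffContOnCl ℂ S uDisc) {z : ℂ} (hz : z ∈ uDisc) :
    ∫ θ, (Pk z θ : ℂ) * S (bd θ) ∂m = S z := by
  have := hS.circleAverage_re_herglotzRieszKernel_smul hz
  rw [← this, ← integral_bd]
  apply integral_congr_ae
  filter_upwards with θ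
  simp [Pk, herglotzRieszKernel]

lemma Pk_int {z : ℂ} (hz : z ∈ uDisc) : Integrable (Pk z) m := by
  exact (Pk_continuous hz).integrable_of_hasCompactSupport (HasCompactSupport.of_compactSpace _)

lemma cont_int {E : Type*} [NormedAddCommGroup E] {g : Tc → E} (hg : Continuous g) :
    Integrable g m :=
  hg.integrable_of_hasCompactSupport (HasCompactSupport.of_compactSpace _)

lemma poisson_re {S : ℂ → ℂ} (hS : DiffContOnCl ℂ S uDisc)
    (hc : Continuous fun θ => S (bd θ)) {z : ℂ} (hz : z ∈ uDisc) :
    ∫ θ, Pk z θ * (S (bd θ)).re ∂m = (S z).re := by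
  rw [← poisson_hol hS hz]
  have h : Integrable (fun θ => (Pk z θ : ℂ) * S (bd θ)) m :=
    cont_int ((Complex.continuous_ofReal.comp (Pk_continuous hz)).mul hc)
  have := integral_re h
  simp only [RCLike.re_to_complex] at this
  rw [← this]
  simp

lemma Pk_integral {z : ℂ} (hz : z ∈ uDisc) : ∫ θ, Pk z θ ∂m = 1 := by
  have := poisson_re (S := fun _ => 1) diffContOnCl_const continuous_const hz
  simpa using this

lemma Pk_mul_int {z : ℂ} (hz : z ∈ uDisc) {u : Tc → ℝ} (hu : Integrable u m) :
    Integrable (fun θ => Pk z θ * u θ) m := by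
  refine hu.bdd_mul (c := (1 + ‖z‖) / (1 - ‖z‖)) (Pk_continuous hz).aestronglyMeasurable ?_
  filter_upwards with θ
  rw [Real.norm_of_nonneg (Pk_pos hz θ).le]
  exact Pk_le hz θ

lemma mean_value {g : ℂ → ℂ} (hg : HolDisc g) {r : ℝ} (h0 : 0 ≤ r) (h1 : r < 1) :
    ∫ θ, g (r * bd θ) ∂m = g 0 := by
  rw [integral_bd (fun w => g (r * w))]
  have hd : DiffContOnCl ℂ (fun w => g (r * w)) (ball 0 |1|) := by
    apply DifferentiableOn.diffContOnCl
    have hcl : closure (ball (0 : ℂ) |1|) = closedBall 0 1 := by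
      rw [abs_one, closure_ball _ one_ne_zero]
    rw [hcl]
    refine hg.comp (by fun_prop) ?_
    intro w hw
    simp only [mem_closedBall, dist_zero_right] at hw
    simp only [mem_ball, dist_zero_right, norm_mul, norm_real, Real.norm_eq_abs, abs_of_nonneg h0]
    nlinarith [norm_nonneg w]
  rw [hd.circleAverage]; simp

lemma dil_diffcont {g : ℂ → ℂ} (hg : HolDisc g) {r : ℝ} (h0 : 0 ≤ r) (h1 : r < 1) :
    DiffContOnCl ℂ (fun w => g (r * w)) uDisc := by
  apply DifferentiableOn.diffContOnCl
  rw [closure_ball _ one_ne_zero]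
  refine hg.comp (by fun_prop) ?_
  intro w hw
  simp only [mem_closedBall, dist_zero_right] at hw
  simp only [mem_ball, dist_zero_right, norm_mul, norm_real, Real.norm_eq_abs, abs_of_nonneg h0]
  nlinarith [norm_nonneg w]

lemma rbd_mem {r : ℝ} (h0 : 0 ≤ r) (h1 : r < 1) (θ : Tc) : (r : ℂ) * bd θ ∈ uDisc := by
  simp [norm_bd, abs_of_nonneg h0, h1]

lemma dil_cont {g : ℂ → ℂ} (hg : HolDisc g) {r : ℝ} (h0 : 0 ≤ r) (h1 : r < 1) :
    Continuous (fun θ => g (r * bd θ)) := by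
  refine hg.continuousOn.comp_continuous (continuous_const.mul bd_continuous) (rbd_mem h0 h1)

/-- Approximation of continuous functions by real parts of entire functions. -/
lemma approx_re (v : Tc → ℝ) (hv : Continuous v) {δ : ℝ} (hδ : 0 < δ) :
    ∃ S : ℂ → ℂ, Differentiable ℂ S ∧ ∀ θ, |(S (bd θ)).re - v θ| ≤ δ := by
  have key0 : ∀ q ∈ Submodule.span ℂ (Set.range (@fourier (2 * Real.pi))),
      ∃ S T : ℂ → ℂ, Differentiable ℂ S ∧ Differentiable ℂ T ∧
        ∀ θ, q θ = S (bd θ) + conj (T (bd θ)) := by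
    intro q hq
    induction hq using Submodule.span_induction with
    | mem x hx =>
      obtain ⟨n, rfl⟩ := hx
      obtain ⟨k, rfl | rfl⟩ := n.eq_nat_or_neg
      · exact ⟨fun z => z ^ k, fun _ => 0, by fun_prop, by fun_prop, fun θ => by rw [bd_pow]; simp⟩
      · refine ⟨fun _ => 0, fun z => z ^ k, by fun_prop, by fun_prop, fun θ => ?_⟩
        rw [fourier_neg, bd_pow]; simp
    | zero => exact ⟨fun _ => 0, fun _ => 0, by fun_prop, by fun_prop, fun θ => by simp⟩
    | add x y _ _ hx hy =>
      obtain ⟨S, T, hS, hT, h1⟩ := hx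
      obtain ⟨S', T', hS', hT', h2⟩ := hy
      exact ⟨fun z => S z + S' z, fun z => T z + T' z, hS.add hS', hT.add hT',
        fun θ => by simp [h1, h2]; ring⟩
    | smul c x _ hx =>
      obtain ⟨S, T, hS, hT, h1⟩ := hx
      exact ⟨fun z => c * S z, fun z => conj c * T z, hS.const_mul _, hT.const_mul _,
        fun θ => by simp [h1]; ring⟩
  have key : ∀ q ∈ Submodule.span ℂ (Set.range (@fourier (2 * Real.pi))),
      ∃ S : ℂ → ℂ, Differentiable ℂ S ∧ ∀ θ, (S (bd θ)).re = (q θ).re := by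
    intro q hq
    obtain ⟨S, T, hS, hT, h1⟩ := key0 q hq
    exact ⟨fun z => S z + T z, hS.add hT, fun θ => by simp [h1]⟩
  let V : C(Tc, ℂ) := ⟨fun θ => (v θ : ℂ), by fun_prop⟩
  have hV : V ∈ (Submodule.span ℂ (Set.range (@fourier (2 * Real.pi)))).topologicalClosure := by
    rw [span_fourier_closure_eq_top]; trivial
  have hV' : V ∈ closure (Submodule.span ℂ (Set.range (@fourier (2 * Real.pi))) : Set C(Tc, ℂ)) := hV
  obtain ⟨q, hq, hd⟩ := Metric.mem_closure_iff.1 hV' δ hδ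
  obtain ⟨S, hS, h⟩ := key q hq
  refine ⟨S, hS, fun θ => ?_⟩
  rw [h]
  have h1 : dist (V θ) (q θ) ≤ dist V q := ContinuousMap.dist_apply_le_dist θ
  have h2 : |(q θ - V θ).re| ≤ ‖q θ - V θ‖ := Complex.abs_re_le_norm _
  rw [dist_comm, dist_eq_norm] at h1
  have h3 : (q θ - V θ).re = (q θ).re - v θ := by simp [V]
  rw [h3] at h2
  linarith

/-- Subharmonicity-type estimate. -/
lemma subharm {h : ℂ → ℂ} (hh : DiffContOnCl ℂ h uDisc) {v : Tc → ℝ} (hv : Continuous v)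
    (hle : ∀ θ, ‖h (bd θ)‖ ≤ Real.exp (v θ)) {z : ℂ} (hz : z ∈ uDisc) :
    ‖h z‖ ≤ Real.exp (∫ θ, Pk z θ * v θ ∂m) := by
  have main : ∀ δ : ℝ, 0 < δ → ‖h z‖ ≤ Real.exp (∫ θ, Pk z θ * v θ ∂m + 2 * δ) := by
    intro δ hδ
    obtain ⟨S, hS, hSv⟩ := approx_re v hv hδ
    have hd : DiffContOnCl ℂ (fun w => h w * Complex.exp (-S w)) uDisc :=
      hh.smul (f := fun w => Complex.exp (-S w)) (c := h)
        (hS.neg.cexp.diffContOnCl)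
    have hb : ‖h z * Complex.exp (-S z)‖ ≤ Real.exp δ := by
      refine Complex.norm_le_of_forall_mem_frontier_norm_le isBounded_ball hd ?_ (subset_closure hz)
      intro w hw
      rw [frontier_ball _ one_ne_zero] at hw
      obtain ⟨θ, rfl⟩ : ∃ θ : Tc, bd θ = w := by
        have hw' : w ∈ sphere (0 : ℂ) |1| := by simpa using hw
        rw [← range_circleMap] at hw'
        obtain ⟨x, rfl⟩ := hw'
        exact ⟨(x : Tc), bd_coe x⟩
      rw [norm_mul, Complex.norm_exp]
      calc ‖h (bd θ)‖ * Real.exp (-S (bd θ)).re ≤ Real.exp (v θ) * Real.exp (-S (bd θ)).re := by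
            gcongr; exact hle θ
        _ = Real.exp (v θ - (S (bd θ)).re) := by rw [← Real.exp_add]; simp [sub_eq_add_neg]
        _ ≤ Real.exp δ := by
            apply Real.exp_le_exp.2
            have := abs_le.1 (hSv θ)
            linarith [this.1]
    have hSz : (S z).re ≤ ∫ θ, Pk z θ * v θ ∂m + δ := by
      have hSc : Continuous fun θ => S (bd θ) := hS.continuous.comp bd_continuous
      rw [← poisson_re hS.diffContOnCl hSc hz]
      have e : ∫ θ, Pk z θ * v θ ∂m + δ = ∫ θ, Pk z θ * (v θ + δ) ∂m := by
        simp_rw [mul_add]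
        rw [integral_add (Pk_mul_int hz (cont_int hv)) ((Pk_int hz).mul_const _), integral_mul_const,
          Pk_integral hz, one_mul]
      rw [e]
      apply integral_mono
      · exact Pk_mul_int hz (cont_int (Complex.continuous_re.comp hSc))
      · exact Pk_mul_int hz (cont_int (hv.add continuous_const))
      · intro θ
        apply mul_le_mul_of_nonneg_left _ (Pk_pos hz θ).le
        have := abs_le.1 (hSv θ)
        linarith [this.2]
    rw [norm_mul, Complex.norm_exp] at hb
    have h3 : ‖h z‖ = (‖h z‖ * Real.exp (-S z).re) * Real.exp (S z).re := by
      rw [mul_assoc, ← Real.exp_add]; simp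
    rw [h3]
    calc _ ≤ Real.exp δ * Real.exp (∫ θ, Pk z θ * v θ ∂m + δ) := by
            gcongr
      _ = _ := by rw [← Real.exp_add]; ring_nf
  have ht : Tendsto (fun δ : ℝ => Real.exp (∫ θ, Pk z θ * v θ ∂m + 2 * δ)) (nhdsWithin 0 (Ioi 0))
      (nhds (Real.exp (∫ θ, Pk z θ * v θ ∂m + 2 * 0))) := by
    apply tendsto_nhdsWithin_of_tendsto_nhds
    apply Continuous.tendsto
    fun_prop
  have := ge_of_tendsto ht (by filter_upwards [self_mem_nhdsWithin] with δ hδ using main δ hδ)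
  simpa using this

/-- radii tending to one -/
def rs (n : ℕ) : ℝ := 1 - 1 / ((n : ℝ) + 1)

lemma rs_nonneg (n : ℕ) : 0 ≤ rs n := by
  unfold rs
  have : 1 / ((n : ℝ) + 1) ≤ 1 := by
    rw [div_le_one (by positivity)]; linarith [n.cast_nonneg (α := ℝ)]
  linarith

lemma rs_lt (n : ℕ) : rs n < 1 := by
  unfold rs
  have : 0 < 1 / ((n : ℝ) + 1) := by positivity
  linarith

lemma rs_tendsto : Tendsto rs atTop (nhds 1) := by
  have := (tendsto_one_div_add_atTop_nhds_zero_nat (𝕜 := ℝ)).const_sub 1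
  rw [sub_zero] at this
  exact this

lemma rs_tendsto' : Tendsto rs atTop (nhdsWithin 1 (Iio 1)) :=
  tendsto_nhdsWithin_of_tendsto_nhds_of_eventually_within _ rs_tendsto
    (Eventually.of_forall rs_lt)

/-- Convergence in `L¹` of dilates. -/
def L1conv (h : ℂ → ℂ) (H : Tc → ℂ) : Prop :=
  HolDisc h ∧ Integrable H m ∧
    Tendsto (fun n => ∫ θ, ‖h (rs n * bd θ) - H θ‖ ∂m) atTop (nhds 0)

lemma l1conv_of {h : ℂ → ℂ} {H : Tc → ℂ} (hh : MemHp 2 h) (hH : Integrable H m)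
    (hb : IsBdry h H) : L1conv h H := by
  refine ⟨hh.1, hH, ?_⟩
  obtain ⟨hd, C, hC⟩ := hh
  have hcont : ∀ n, Continuous fun θ => h (rs n * bd θ) := fun n =>
    dil_cont hd (rs_nonneg n) (rs_lt n)
  have hui : UnifIntegrable (fun n θ => h (rs n * bd θ)) 1 m := by
    apply unifIntegrable_of le_rfl (by simp) (fun n => (hcont n).aestronglyMeasurable)
    intro ε hε
    have hC0 : 0 ≤ C := le_trans (integral_nonneg (fun θ => by positivity)) (hC 0 le_rfl one_pos)
    refine ⟨⟨(C + 1) / ε, by positivity⟩, fun n => ?_⟩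
    rw [eLpNorm_one_eq_lintegral_enorm]
    have hsq : Integrable (fun θ => ε / (C + 1) * ‖h (rs n * bd θ)‖ ^ (2 : ℝ)) m := by
      apply cont_int
      have := hcont n
      exact continuous_const.mul (this.norm.rpow_const (fun _ => Or.inr (by norm_num)))
    calc _ ≤ ∫⁻ θ, ENNReal.ofReal (ε / (C + 1) * ‖h (rs n * bd θ)‖ ^ (2 : ℝ)) ∂m := by
          apply lintegral_mono
          intro θ
          by_cases hx : θ ∈ {x | (⟨(C + 1) / ε, by positivity⟩ : NNReal) ≤ ‖h (rs n * bd x)‖₊}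
          · refine le_trans (le_of_eq (congrArg enorm
              (indicator_of_mem hx (fun θ => h (rs n * bd θ))))) ?_
            rw [← ofReal_norm]
            apply ENNReal.ofReal_le_ofReal
            have hx' : (C + 1) / ε ≤ ‖h (rs n * bd θ)‖ := by
              have : (⟨(C + 1) / ε, by positivity⟩ : NNReal) ≤ ‖h (rs n * bd θ)‖₊ := hx
              exact_mod_cast this
            rw [div_le_iff₀ hε] at hx'
            rw [Real.rpow_two, div_mul_eq_mul_div, le_div_iff₀ (by positivity)]
            nlinarith [norm_nonneg (h (rs n * bd θ))]
          · refine le_trans (le_of_eq (congrArg enorm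
              (indicator_of_notMem hx (fun θ => h (rs n * bd θ))))) ?_
            simp
      _ = ENNReal.ofReal (∫ θ, ε / (C + 1) * ‖h (rs n * bd θ)‖ ^ (2 : ℝ) ∂m) := by
          rw [ofReal_integral_eq_lintegral_ofReal hsq]
          filter_upwards with θ
          positivity
      _ ≤ ENNReal.ofReal ε := by
          apply ENNReal.ofReal_le_ofReal
          rw [integral_const_mul]
          calc _ ≤ ε / (C + 1) * C := by
                gcongr; exact hC _ (rs_nonneg n) (rs_lt n)
            _ ≤ ε := by
                rw [div_mul_eq_mul_div, div_le_iff₀ (by positivity)]; nlinarith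
  have := tendsto_Lp_finite_of_tendsto_ae le_rfl (by simp)
    (fun n => (hcont n).aestronglyMeasurable) (memLp_one_iff_integrable.2 hH) hui (by
      filter_upwards [hb] with θ hθ
      exact hθ.comp rs_tendsto')
  have h2 := (ENNReal.tendsto_toReal ENNReal.zero_ne_top).comp this
  simp only [ENNReal.toReal_zero] at h2
  refine h2.congr fun n => ?_
  simp only [Function.comp]
  rw [eLpNorm_one_eq_lintegral_enorm, integral_norm_eq_lintegral_enorm]
  · rfl
  · exact (hcont n).aestronglyMeasurable.sub hH.aestronglyMeasurable

lemma logmax_lip {ε : ℝ} (hε : 0 < ε) (x y : ℝ) :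
    |Real.log (max x ε) - Real.log (max y ε)| ≤ |x - y| / ε := by
  have aux : ∀ x y : ℝ, Real.log (max x ε) - Real.log (max y ε) ≤ |x - y| / ε := by
    intro x y
    have hx : 0 < max x ε := lt_of_lt_of_le hε (le_max_right _ _)
    have hy : 0 < max y ε := lt_of_lt_of_le hε (le_max_right _ _)
    rw [← Real.log_div hx.ne' hy.ne']
    calc _ ≤ max x ε / max y ε - 1 := Real.log_le_sub_one_of_pos (by positivity)
      _ = (max x ε - max y ε) / max y ε := by field_simp
      _ ≤ |x - y| / max y ε := by
          gcongr
          exact (le_abs_self _).trans (abs_max_sub_max_le_abs x y ε)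
      _ ≤ |x - y| / ε := by
          gcongr
          exact le_max_right _ _
  rw [abs_le]
  constructor
  · have := aux y x
    rw [abs_sub_comm] at this
    linarith
  · exact aux x y

lemma logmax_meas {H : Tc → ℂ} (hH : AEStronglyMeasurable H m) (ε : ℝ) :
    AEStronglyMeasurable (fun θ => Real.log (max ‖H θ‖ ε)) m :=
  (Real.measurable_log.comp_aemeasurable
    (hH.norm.aemeasurable.max aemeasurable_const)).aestronglyMeasurable

lemma logmax_int {H : Tc → ℂ} (hH : Integrable H m) {ε : ℝ} (hε : 0 < ε) :
    Integrable (fun θ => Real.log (max ‖H θ‖ ε)) m := by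
  refine Integrable.mono' (g := fun θ => |Real.log ε| + ‖H θ‖ / ε)
    ((integrable_const _).add (hH.norm.div_const _)) (logmax_meas hH.1 ε) ?_
  filter_upwards with θ
  have := logmax_lip hε ‖H θ‖ 0
  rw [max_eq_right hε.le, sub_zero, abs_of_nonneg (norm_nonneg _)] at this
  rw [Real.norm_eq_abs]
  calc _ = |Real.log ε + (Real.log (max ‖H θ‖ ε) - Real.log ε)| := by ring_nf
    _ ≤ _ := (abs_add_le _ _).trans (by gcongr)

/-- If `u n → u` in `L¹`, Poisson integrals converge. -/
lemma poisson_tendsto {u : ℕ → Tc → ℝ} {v : Tc → ℝ} (hu : ∀ n, Integrable (u n) m)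
    (hv : Integrable v m) (h : Tendsto (fun n => ∫ θ, |u n θ - v θ| ∂m) atTop (nhds 0))
    {z : ℂ} (hz : z ∈ uDisc) :
    Tendsto (fun n => ∫ θ, Pk z θ * u n θ ∂m) atTop (nhds (∫ θ, Pk z θ * v θ ∂m)) := by
  rw [tendsto_iff_norm_sub_tendsto_zero]
  have h2 := h.const_mul ((1 + ‖z‖) / (1 - ‖z‖))
  rw [mul_zero] at h2
  refine squeeze_zero (fun _ => norm_nonneg _) (fun n => ?_) h2
  rw [← integral_sub (Pk_mul_int hz (hu n)) (Pk_mul_int hz hv), ← integral_const_mul]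
  refine norm_integral_le_of_norm_le (((hu n).sub hv).abs.const_mul _) ?_
  filter_upwards with θ
  rw [← mul_sub, norm_mul, Real.norm_of_nonneg (Pk_pos hz θ).le, Real.norm_eq_abs]
  exact mul_le_mul_of_nonneg_right (Pk_le hz θ) (abs_nonneg _)

lemma rsz_mem {z : ℂ} (hz : z ∈ uDisc) (n : ℕ) : (rs n : ℂ) * z ∈ uDisc := by
  have h1 : ‖z‖ < 1 := by simpa using hz
  simp only [mem_ball, dist_zero_right, norm_mul, norm_real, Real.norm_eq_abs,
    abs_of_nonneg (rs_nonneg n)]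
  nlinarith [rs_lt n, rs_nonneg n, norm_nonneg z]

lemma rsz_tendsto {h : ℂ → ℂ} (hh : HolDisc h) {z : ℂ} (hz : z ∈ uDisc) :
    Tendsto (fun n => h (rs n * z)) atTop (nhds (h z)) := by
  have hc : ContinuousAt h z := (hh.continuousOn).continuousAt (isOpen_ball.mem_nhds hz)
  have : Tendsto (fun n => (rs n : ℂ) * z) atTop (nhds z) := by
    have := ((Complex.continuous_ofReal.tendsto 1).comp rs_tendsto).mul_const z
    simpa [Function.comp_def] using this
  exact hc.tendsto.comp this

lemma jensen_eps {h : ℂ → ℂ} {H : Tc → ℂ} (hh : L1conv h H) {z : ℂ} (hz : z ∈ uDisc)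
    {ε : ℝ} (hε : 0 < ε) :
    ‖h z‖ ≤ Real.exp (∫ θ, Pk z θ * Real.log (max ‖H θ‖ ε) ∂m) := by
  obtain ⟨hd, hH, ht⟩ := hh
  have hc : ∀ n, Continuous fun θ => h (rs n * bd θ) := fun n =>
    dil_cont hd (rs_nonneg n) (rs_lt n)
  have hpos : ∀ x : ℝ, 0 < max x ε := fun x => lt_of_lt_of_le hε (le_max_right _ _)
  have hcv : ∀ n, Continuous fun θ => Real.log (max ‖h (rs n * bd θ)‖ ε) := fun n =>
    ((hc n).norm.max continuous_const).log (fun θ => (hpos _).ne')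
  have h1 : ∀ n, ‖h (rs n * z)‖ ≤
      Real.exp (∫ θ, Pk z θ * Real.log (max ‖h (rs n * bd θ)‖ ε) ∂m) := by
    intro n
    refine subharm (h := fun w => h (rs n * w)) (dil_diffcont hd (rs_nonneg n) (rs_lt n))
      (hcv n) (fun θ => ?_) hz
    rw [Real.exp_log (hpos _)]
    exact le_max_left _ _
  have h2 := poisson_tendsto (fun n => cont_int (hcv n)) (logmax_int hH hε) (by
    have h3 := ht.div_const ε
    rw [zero_div] at h3
    refine squeeze_zero (fun _ => integral_nonneg (fun _ => abs_nonneg _)) (fun n => ?_) h3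
    rw [← integral_div]
    apply integral_mono
    · exact ((cont_int (hcv n)).sub (logmax_int hH hε)).abs
    · exact ((cont_int (hc n)).sub hH).norm.div_const _
    · intro θ
      refine (logmax_lip hε _ _).trans ?_
      have := abs_norm_sub_norm_le (h (rs n * bd θ)) (H θ)
      dsimp only
      gcongr) hz
  exact le_of_tendsto_of_tendsto (rsz_tendsto hd hz).norm
    ((Real.continuous_exp.tendsto _).comp h2) (Eventually.of_forall h1)

lemma jensen {h : ℂ → ℂ} {H : Tc → ℂ} (hh : L1conv h H) {z : ℂ} (hz : z ∈ uDisc)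
    (hne : h z ≠ 0) :
    (∀ᵐ θ ∂m, H θ ≠ 0) ∧ Integrable (fun θ => Real.log ‖H θ‖) m ∧
      Real.log ‖h z‖ ≤ ∫ θ, Pk z θ * Real.log ‖H θ‖ ∂m := by
  have hH : Integrable H m := hh.2.1
  set e : ℕ → ℝ := fun k => Real.exp (-(k : ℝ)) with he
  have hepos : ∀ k, 0 < e k := fun k => Real.exp_pos _
  have hele : ∀ k, e k ≤ 1 := fun k => by simp [he]
  have hJ : ∀ k, Real.log ‖h z‖ ≤ ∫ θ, Pk z θ * Real.log (max ‖H θ‖ (e k)) ∂m := by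
    intro k
    have := Real.log_le_log (norm_pos_iff.2 hne) (jensen_eps hh hz (hepos k))
    rwa [Real.log_exp] at this
  set ψ : ℕ → Tc → ℝ := fun k θ => Real.log (max ‖H θ‖ 1) - Real.log (max ‖H θ‖ (e k)) with hψ
  have hψint : ∀ k, Integrable (ψ k) m := fun k =>
    (logmax_int hH one_pos).sub (logmax_int hH (hepos k))
  have hψ0 : ∀ k θ, 0 ≤ ψ k θ := by
    intro k θ
    have := Real.log_le_log (lt_of_lt_of_le (hepos k) (le_max_right ‖H θ‖ (e k)))
      (max_le_max_left ‖H θ‖ (hele k))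
    simp only [hψ]; linarith
  have hψmono : ∀ θ, Monotone fun k => ψ k θ := by
    intro θ k l hkl
    have h1 : e l ≤ e k := by
      simp only [he]; apply Real.exp_le_exp.2; simpa using hkl
    have := Real.log_le_log (lt_of_lt_of_le (hepos l) (le_max_right ‖H θ‖ (e l)))
      (max_le_max_left ‖H θ‖ h1)
    simp only [hψ]; linarith
  set c : ℝ := (1 - ‖z‖) / (1 + ‖z‖) with hc
  have hzn : ‖z‖ < 1 := by simpa using hz
  have hcpos : 0 < c := div_pos (by linarith) (by positivity)
  set M : ℝ := (∫ θ, Pk z θ * Real.log (max ‖H θ‖ 1) ∂m - Real.log ‖h z‖) / c with hM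
  have hψle : ∀ k, ∫ θ, ψ k θ ∂m ≤ M := by
    intro k
    rw [hM, le_div_iff₀ hcpos, mul_comm, ← integral_const_mul]
    calc ∫ θ, c * ψ k θ ∂m ≤ ∫ θ, Pk z θ * ψ k θ ∂m := by
          apply integral_mono ((hψint k).const_mul _) (Pk_mul_int hz (hψint k))
          intro θ
          exact mul_le_mul_of_nonneg_right (Pk_lower hz θ) (hψ0 k θ)
      _ = ∫ θ, Pk z θ * Real.log (max ‖H θ‖ 1) ∂m
            - ∫ θ, Pk z θ * Real.log (max ‖H θ‖ (e k)) ∂m := by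
          simp only [hψ, mul_sub]
          exact integral_sub (Pk_mul_int hz (logmax_int hH one_pos))
            (Pk_mul_int hz (logmax_int hH (hepos k)))
      _ ≤ _ := by linarith [hJ k]
  have hsup : ∫⁻ θ, ⨆ k, ENNReal.ofReal (ψ k θ) ∂m ≤ ENNReal.ofReal M := by
    rw [lintegral_iSup' (fun k => (hψint k).aemeasurable.ennreal_ofReal)
      (Eventually.of_forall fun θ k l hkl => ENNReal.ofReal_le_ofReal (hψmono θ hkl))]
    refine iSup_le fun k => ?_
    rw [← ofReal_integral_eq_lintegral_ofReal (hψint k) (Eventually.of_forall (hψ0 k))]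
    exact ENNReal.ofReal_le_ofReal (hψle k)
  have hsupm : AEMeasurable (fun θ => ⨆ k, ENNReal.ofReal (ψ k θ)) m :=
    AEMeasurable.iSup fun k => (hψint k).aemeasurable.ennreal_ofReal
  have hlt : ∀ᵐ θ ∂m, (⨆ k, ENNReal.ofReal (ψ k θ)) < ⊤ :=
    ae_lt_top' hsupm (hsup.trans_lt ENNReal.ofReal_lt_top).ne
  have hne0 : ∀ᵐ θ ∂m, H θ ≠ 0 := by
    filter_upwards [hlt] with θ hθ h0
    have hk : ∀ k : ℕ, (k : ENNReal) ≤ ⨆ k, ENNReal.ofReal (ψ k θ) := by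
      intro k
      refine le_trans ?_ (le_iSup _ k)
      have : ψ k θ = k := by
        simp only [hψ, h0, norm_zero]
        rw [max_eq_right zero_le_one, max_eq_right (hepos k).le]
        simp [he]
      rw [this, ENNReal.ofReal_natCast]
    obtain ⟨n, hn⟩ := ENNReal.exists_nat_gt hθ.ne
    exact absurd (hk n) (not_le.2 hn)
  have hmeas : AEStronglyMeasurable (fun θ => Real.log ‖H θ‖) m :=
    (Real.measurable_log.comp_aemeasurable hH.1.norm.aemeasurable).aestronglyMeasurable
  have hSint : Integrable (fun θ => (⨆ k, ENNReal.ofReal (ψ k θ)).toReal) m :=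
    integrable_toReal_of_lintegral_ne_top hsupm (hsup.trans_lt ENNReal.ofReal_lt_top).ne
  have hek : ∀ θ, H θ ≠ 0 → ∃ K : ℕ, ∀ k ≥ K, e k ≤ ‖H θ‖ := by
    intro θ hθ
    have ht : Tendsto e atTop (nhds 0) :=
      Real.tendsto_exp_neg_atTop_nhds_zero.comp tendsto_natCast_atTop_atTop
    have := ht.eventually (gt_mem_nhds (norm_pos_iff.2 hθ))
    obtain ⟨K, hK⟩ := eventually_atTop.1 this
    exact ⟨K, fun k hk => (hK k hk).le⟩
  have hlogint : Integrable (fun θ => Real.log ‖H θ‖) m := by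
    refine Integrable.mono' (g := fun θ => |Real.log (max ‖H θ‖ 1)| +
      (⨆ k, ENNReal.ofReal (ψ k θ)).toReal) ((logmax_int hH one_pos).abs.add hSint) hmeas ?_
    filter_upwards [hlt, hne0] with θ h1 h2
    obtain ⟨K, hK⟩ := hek θ h2
    have h3 : ψ K θ = Real.log (max ‖H θ‖ 1) - Real.log ‖H θ‖ := by
      simp only [hψ]; rw [max_eq_left (hK K le_rfl)]
    have h4 : ψ K θ ≤ (⨆ k, ENNReal.ofReal (ψ k θ)).toReal := by
      have := ENNReal.toReal_mono h1.ne (le_iSup (fun k => ENNReal.ofReal (ψ k θ)) K)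
      rwa [ENNReal.toReal_ofReal (hψ0 K θ)] at this
    rw [Real.norm_eq_abs]
    calc |Real.log ‖H θ‖| = |Real.log (max ‖H θ‖ 1) - ψ K θ| := by rw [h3]; ring_nf
      _ ≤ |Real.log (max ‖H θ‖ 1)| + |ψ K θ| := abs_sub _ _
      _ ≤ _ := by rw [abs_of_nonneg (hψ0 K θ)]; gcongr
  refine ⟨hne0, hlogint, ?_⟩
  have hlim : Tendsto (fun k => ∫ θ, Pk z θ * Real.log (max ‖H θ‖ (e k)) ∂m) atTop
      (nhds (∫ θ, Pk z θ * Real.log ‖H θ‖ ∂m)) := by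
    apply tendsto_integral_of_dominated_convergence (fun θ => Pk z θ * |Real.log ‖H θ‖|)
    · intro k
      exact (Pk_mul_int hz (logmax_int hH (hepos k))).1
    · exact Pk_mul_int hz hlogint.abs
    · intro k
      filter_upwards [hne0] with θ hθ
      rw [norm_mul, Real.norm_of_nonneg (Pk_pos hz θ).le, Real.norm_eq_abs]
      refine mul_le_mul_of_nonneg_left ?_ (Pk_pos hz θ).le
      rcases le_total (e k) ‖H θ‖ with hk | hk
      · rw [max_eq_left hk]
      · rw [max_eq_right hk]
        have h5 := Real.log_le_log (norm_pos_iff.2 hθ) hk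
        have h6 : Real.log (e k) ≤ 0 := by simp [he]
        rw [abs_of_nonpos h6, abs_of_nonpos (h5.trans h6)]
        linarith
    · filter_upwards [hne0] with θ hθ
      obtain ⟨K, hK⟩ := hek θ hθ
      apply tendsto_const_nhds.congr'
      filter_upwards [eventually_ge_atTop K] with k hk
      rw [max_eq_left (hK k hk)]
  exact ge_of_tendsto hlim (Eventually.of_forall hJ)

lemma approx_L1 {u : Tc → ℝ} (hu : Integrable u m) {δ : ℝ} (hδ : 0 < δ) :
    ∃ S : ℂ → ℂ, Differentiable ℂ S ∧ ∫ θ, |(S (bd θ)).re - u θ| ∂m ≤ δ := by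
  have : m.WeaklyRegular := by unfold m; infer_instance
  obtain ⟨g, hg, hgi⟩ := hu.exists_boundedContinuous_integral_sub_le (half_pos hδ)
  obtain ⟨S, hS, hSv⟩ := approx_re g g.continuous (half_pos hδ)
  refine ⟨S, hS, ?_⟩
  have hSc : Continuous fun θ => (S (bd θ)).re :=
    Complex.continuous_re.comp (hS.continuous.comp bd_continuous)
  have i1 : Integrable (fun θ => |(S (bd θ)).re - u θ|) m := ((cont_int hSc).sub hu).abs
  have i2 : Integrable (fun θ => ‖u θ - g θ‖) m := (hu.sub hgi).norm
  have i3 : Integrable (fun θ => δ / 2 + ‖u θ - g θ‖) m := (integrable_const _).add i2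
  calc ∫ θ, |(S (bd θ)).re - u θ| ∂m ≤ ∫ θ, (δ / 2 + ‖u θ - g θ‖) ∂m := by
        apply integral_mono i1 i3
        intro θ
        have := hSv θ
        have h2 := abs_sub_le (S (bd θ)).re (g θ) (u θ)
        rw [abs_sub_comm (g θ)] at h2
        simp only [Real.norm_eq_abs]
        linarith
    _ = δ / 2 + ∫ θ, ‖u θ - g θ‖ ∂m := by
        rw [integral_add (integrable_const _) i2]; simp
    _ ≤ δ := by linarith

/-- Poisson integral. -/
def PI (u : Tc → ℝ) (z : ℂ) : ℝ := ∫ φ, Pk z φ * u φ ∂m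

lemma PI_sub {u v : Tc → ℝ} (hu : Integrable u m) (hv : Integrable v m) {z : ℂ}
    (hz : z ∈ uDisc) : PI (fun θ => u θ - v θ) z = PI u z - PI v z := by
  unfold PI
  simp only [mul_sub]
  exact integral_sub (Pk_mul_int hz hu) (Pk_mul_int hz hv)

lemma Pk_joint_cont {r : ℝ} (h0 : 0 ≤ r) (h1 : r < 1) :
    Continuous (fun x : Tc × Tc => Pk (r * bd x.1) x.2) := by
  unfold Pk
  have c1 : Continuous fun x : Tc × Tc => bd x.1 := bd_continuous.comp continuous_fst
  have c2 : Continuous fun x : Tc × Tc => bd x.2 := bd_continuous.comp continuous_snd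
  refine Complex.continuous_re.comp (Continuous.div ?_ ?_ ?_)
  · exact c2.add (continuous_const.mul c1)
  · exact c2.sub (continuous_const.mul c1)
  · intro x
    exact bd_sub_ne (rbd_mem h0 h1 _) _

lemma Pk_joint_int {u : Tc → ℝ} (hu : Integrable u m) {r : ℝ} (h0 : 0 ≤ r) (h1 : r < 1) :
    Integrable (fun x : Tc × Tc => Pk (r * bd x.1) x.2 * u x.2) (m.prod m) := by
  have h2 : Integrable (fun x : Tc × Tc => u x.2) (m.prod m) := hu.comp_snd m
  refine h2.bdd_mul (c := (1 + r) / (1 - r)) (Pk_joint_cont h0 h1).aestronglyMeasurable ?_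
  filter_upwards with x
  have hz := rbd_mem h0 h1 x.1
  rw [Real.norm_of_nonneg (Pk_pos hz _).le]
  have := Pk_le hz x.2
  simpa [norm_bd, abs_of_nonneg h0] using this

lemma PI_contract {u : Tc → ℝ} (hu : Integrable u m) {r : ℝ} (h0 : 0 ≤ r) (h1 : r < 1) :
    Integrable (fun θ => PI u (r * bd θ)) m ∧ ∫ θ, |PI u (r * bd θ)| ∂m ≤ ∫ θ, |u θ| ∂m := by
  have hj := Pk_joint_int hu h0 h1
  have hj2 := Pk_joint_int hu.abs h0 h1
  have i1 : Integrable (fun θ => PI u (r * bd θ)) m := hj.integral_prod_left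
  have i2 : Integrable (fun θ => PI (fun θ => |u θ|) (r * bd θ)) m := hj2.integral_prod_left
  refine ⟨i1, ?_⟩
  calc ∫ θ, |PI u (r * bd θ)| ∂m ≤ ∫ θ, PI (fun θ => |u θ|) (r * bd θ) ∂m := by
        apply integral_mono i1.abs i2
        intro θ
        have hz := rbd_mem h0 h1 θ
        refine (abs_integral_le_integral_abs).trans (le_of_eq ?_)
        apply integral_congr_ae
        filter_upwards with φ
        rw [abs_mul, abs_of_pos (Pk_pos hz φ)]
    _ = ∫ φ, ∫ θ, Pk (r * bd θ) φ * |u φ| ∂m ∂m := by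
        unfold PI
        exact integral_integral_swap hj2
    _ = ∫ φ, |u φ| ∂m := by
        apply integral_congr_ae
        filter_upwards with φ
        rw [integral_mul_const]
        have : ∫ θ, Pk (r * bd θ) φ ∂m = 1 := by
          rw [← Pk_integral (rbd_mem h0 h1 φ)]
          apply integral_congr_ae
          filter_upwards with θ
          exact Pk_symm r φ θ
        rw [this, one_mul]

lemma PI_tendsto {u : Tc → ℝ} (hu : Integrable u m) :
    Tendsto (fun n => ∫ θ, |PI u (rs n * bd θ) - u θ| ∂m) atTop (nhds 0) := by
  rw [Metric.tendsto_atTop]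
  intro ε hε
  obtain ⟨S, hS, hSu⟩ := approx_L1 hu (δ := ε / 4) (by linarith)
  set s : Tc → ℝ := fun θ => (S (bd θ)).re with hs
  have hsc : Continuous s := Complex.continuous_re.comp (hS.continuous.comp bd_continuous)
  have hsi : Integrable s m := cont_int hsc
  have hSn : ∀ n, Continuous fun θ => (S (rs n * bd θ)).re := fun n =>
    Complex.continuous_re.comp (hS.continuous.comp (continuous_const.mul bd_continuous))
  have hlim : Tendsto (fun n => ∫ θ, |(S (rs n * bd θ)).re - s θ| ∂m) atTop (nhds 0) := by
    obtain ⟨B, hB⟩ := (isCompact_closedBall (0 : ℂ) 1).exists_bound_of_continuousOn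
      hS.continuous.continuousOn
    have : (0 : ℝ) = ∫ θ : Tc, (0 : ℝ) ∂m := by simp
    rw [this]
    apply tendsto_integral_of_dominated_convergence (fun _ => B + B)
    · intro n
      exact ((hSn n).sub hsc).abs.aestronglyMeasurable
    · exact integrable_const _
    · intro n
      filter_upwards with θ
      rw [Real.norm_eq_abs, abs_abs]
      refine (abs_sub _ _).trans (add_le_add ?_ ?_)
      · exact (Complex.abs_re_le_norm _).trans
          (hB _ (ball_subset_closedBall (rbd_mem (rs_nonneg n) (rs_lt n) θ)))
      · exact (Complex.abs_re_le_norm _).trans (hB _ (sphere_subset_closedBall (bd_mem θ)))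
    · filter_upwards with θ
      have h1 : Tendsto (fun n => (rs n : ℂ) * bd θ) atTop (nhds (bd θ)) := by
        have := ((Complex.continuous_ofReal.tendsto 1).comp rs_tendsto).mul_const (bd θ)
        simpa [Function.comp_def] using this
      have h2 := (Complex.continuous_re.tendsto _).comp ((hS.continuous.tendsto _).comp h1)
      have h3 := (h2.sub_const (s θ)).abs
      simpa [hs, Function.comp_def] using h3
  obtain ⟨N, hN⟩ := (Metric.tendsto_atTop.1 hlim) (ε / 4) (by linarith)
  refine ⟨N, fun n hn => ?_⟩
  have hN' := hN n hn
  rw [Real.dist_eq, sub_zero] at hN' ⊢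
  have hN2 := (le_abs_self _).trans_lt hN'
  rw [abs_of_nonneg (integral_nonneg fun _ => abs_nonneg _)]
  have hds : Integrable (fun θ => s θ - u θ) m := hsi.sub hu
  obtain ⟨c1, c2⟩ := PI_contract hds (rs_nonneg n) (rs_lt n)
  have hsPI : ∀ θ, PI s (rs n * bd θ) = (S (rs n * bd θ)).re := fun θ =>
    poisson_re hS.diffContOnCl (hS.continuous.comp bd_continuous)
      (rbd_mem (rs_nonneg n) (rs_lt n) θ)
  have ha : Integrable (fun θ => |PI (fun θ => s θ - u θ) (rs n * bd θ)|) m := c1.abs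
  have hb : Integrable (fun θ => |(S (rs n * bd θ)).re - s θ|) m :=
    ((cont_int (hSn n)).sub hsi).abs
  have hc : Integrable (fun θ => |s θ - u θ|) m := hds.abs
  have hab : Integrable (fun θ => |PI (fun θ => s θ - u θ) (rs n * bd θ)|
      + |(S (rs n * bd θ)).re - s θ|) m := ha.add hb
  calc ∫ θ, |PI u (rs n * bd θ) - u θ| ∂m
      ≤ ∫ θ, (|PI (fun θ => s θ - u θ) (rs n * bd θ)| + |(S (rs n * bd θ)).re - s θ|
          + |s θ - u θ|) ∂m := by
        apply integral_mono
        · exact ((PI_contract hu (rs_nonneg n) (rs_lt n)).1.sub hu).abs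
        · exact hab.add hc
        · intro θ
          have e1 : PI u (rs n * bd θ) - u θ = -PI (fun θ => s θ - u θ) (rs n * bd θ)
              + ((S (rs n * bd θ)).re - s θ) + (s θ - u θ) := by
            rw [PI_sub hsi hu (rbd_mem (rs_nonneg n) (rs_lt n) θ), hsPI]; ring
          simp only
          rw [e1]
          refine (abs_add_le _ _).trans (add_le_add ((abs_add_le _ _).trans ?_) le_rfl)
          rw [abs_neg]
    _ = ∫ θ, |PI (fun θ => s θ - u θ) (rs n * bd θ)| ∂m + ∫ θ, |(S (rs n * bd θ)).re - s θ| ∂m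
          + ∫ θ, |s θ - u θ| ∂m := by
        rw [integral_add hab hc, integral_add ha hb]
    _ < ε := by linarith

lemma herglotz_re {u : Tc → ℝ} (hu : Integrable u m) {z : ℂ} (hz : z ∈ uDisc) :
    (∫ θ : Tc, ((bd θ + z) / (bd θ - z)) * (u θ : ℂ) ∂m).re = PI u z := by
  obtain ⟨B, hB⟩ := isCompact_univ.exists_bound_of_continuousOn (hk_continuous hz).continuousOn
  have h : Integrable (fun θ : Tc => ((bd θ + z) / (bd θ - z)) * (u θ : ℂ)) m := by
    refine hu.ofReal.bdd_mul (c := B) (hk_continuous hz).aestronglyMeasurable ?_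
    filter_upwards with θ
    exact hB θ (mem_univ _)
  have := integral_re h
  simp only [RCLike.re_to_complex] at this
  rw [← this]
  unfold PI Pk
  simp

/-- The Pythagorean mate is bounded by one. -/
lemma a_le_one (P : BPair) : ∀ z ∈ uDisc, ‖P.a z‖ ≤ 1 := by
  obtain ⟨hd, α, w, hα, hw, hlogint, hform⟩ := P.a_outer
  set u : Tc → ℝ := fun θ => Real.log (w θ) with hu
  have hnorm : ∀ z ∈ uDisc, ‖P.a z‖ = Real.exp (PI u z) := by
    intro z hz
    rw [hform z hz, norm_mul, hα, one_mul, Complex.norm_exp, herglotz_re hlogint hz]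
  have hmeas : TendstoInMeasure m (fun n θ => PI u (rs n * bd θ)) atTop u := by
    refine tendstoInMeasure_of_tendsto_eLpNorm (p := 1) one_ne_zero
      (fun n => (PI_contract hlogint (rs_nonneg n) (rs_lt n)).1.1) hlogint.1 ?_
    have h1 := ENNReal.tendsto_ofReal (PI_tendsto hlogint)
    rw [ENNReal.ofReal_zero] at h1
    refine h1.congr fun n => ?_
    have hi : Integrable (fun θ => |PI u (rs n * bd θ) - u θ|) m :=
      ((PI_contract hlogint (rs_nonneg n) (rs_lt n)).1.sub hlogint).abs
    rw [eLpNorm_one_eq_lintegral_enorm, ofReal_integral_eq_lintegral_ofReal hi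
      (Eventually.of_forall fun _ => abs_nonneg _)]
    apply lintegral_congr
    intro θ
    rw [← ofReal_norm, Real.norm_eq_abs]; rfl
  obtain ⟨ns, hns, hae⟩ := hmeas.exists_seq_tendsto_ae
  have hule : ∀ᵐ θ ∂m, u θ ≤ 0 := by
    filter_upwards [hae, P.a_bdry, P.pyth] with θ h1 h2 h3
    have h4 := (h2.comp (rs_tendsto'.comp hns.tendsto_atTop)).norm
    have h5 := (Real.continuous_exp.tendsto _).comp h1
    have h6 : Real.exp (u θ) = ‖P.as' θ‖ := by
      refine tendsto_nhds_unique h5 (h4.congr fun n => ?_)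
      simp only [Function.comp]
      exact hnorm _ (rbd_mem (rs_nonneg _) (rs_lt _) θ)
    have h7 : ‖P.as' θ‖ ≤ 1 := by nlinarith [norm_nonneg (P.as' θ), norm_nonneg (P.bs θ)]
    rw [← h6] at h7
    simpa using h7
  intro z hz
  rw [hnorm z hz, Real.exp_le_one_iff]
  apply integral_nonpos_of_ae
  filter_upwards [hule] with θ hθ
  exact mul_nonpos_of_nonneg_of_nonpos (Pk_pos hz θ).le hθ

lemma bdry_seq {g : ℂ → ℂ} {G : Tc → ℂ} (hb : IsBdry g G) :
    ∀ᵐ θ ∂m, Tendsto (fun n => g ((rs n : ℂ) * bd θ)) atTop (nhds (G θ)) := by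
  filter_upwards [hb] with θ h
  exact h.comp rs_tendsto'

lemma bdry_meas {g : ℂ → ℂ} {G : Tc → ℂ} (hg : HolDisc g) (hb : IsBdry g G) :
    AEStronglyMeasurable G m :=
  aestronglyMeasurable_of_tendsto_ae atTop
    (fun n => (dil_cont hg (rs_nonneg n) (rs_lt n)).aestronglyMeasurable) (bdry_seq hb)

lemma bdry_le {g : ℂ → ℂ} {G : Tc → ℂ} (hb : IsBdry g G)
    (h1 : ∀ z ∈ uDisc, ‖g z‖ ≤ 1) : ∀ᵐ θ ∂m, ‖G θ‖ ≤ 1 := by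
  filter_upwards [bdry_seq hb] with θ h
  exact le_of_tendsto h.norm (Eventually.of_forall fun n => h1 _ (rbd_mem (rs_nonneg n) (rs_lt n) θ))

lemma bdry_mean {g : ℂ → ℂ} {G : Tc → ℂ} (hg : HolDisc g) (hb : IsBdry g G)
    (h1 : ∀ z ∈ uDisc, ‖g z‖ ≤ 1) : ∫ θ, G θ ∂m = g 0 := by
  have h : Tendsto (fun n => ∫ θ, g ((rs n : ℂ) * bd θ) ∂m) atTop (nhds (∫ θ, G θ ∂m)) := by
    apply tendsto_integral_of_dominated_convergence (fun _ => 1)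
    · exact fun n => (dil_cont hg (rs_nonneg n) (rs_lt n)).aestronglyMeasurable
    · exact integrable_const _
    · intro n
      filter_upwards with θ
      exact h1 _ (rbd_mem (rs_nonneg n) (rs_lt n) θ)
    · exact bdry_seq hb
  simp only [mean_value hg (rs_nonneg _) (rs_lt _)] at h
  exact tendsto_nhds_unique h tendsto_const_nhds |>.symm ▸ rfl

lemma bdry_fourier {g : ℂ → ℂ} {G : Tc → ℂ} (hg : HolDisc g) (hb : IsBdry g G)
    (h1 : ∀ z ∈ uDisc, ‖g z‖ ≤ 1) (k : ℕ) :
    ∫ θ, bd θ ^ k * G θ ∂m = if k = 0 then g 0 else 0 := by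
  have := bdry_mean (g := fun z => z ^ k * g z) (G := fun θ => bd θ ^ k * G θ)
    (DifferentiableOn.mul (by fun_prop) hg) ?_ ?_
  · rw [this]
    split_ifs with hk
    · simp [hk]
    · simp [hk]
  · filter_upwards [hb] with θ hθ
    refine Tendsto.mul ?_ hθ
    have c : Continuous fun r : ℝ => ((r : ℂ) * bd θ) ^ k := by fun_prop
    have := (c.tendsto 1).mono_left (nhdsWithin_le_nhds (s := Iio 1))
    simpa using this
  · intro z hz
    have hz' : ‖z‖ ≤ 1 := by
      have : ‖z‖ < 1 := by simpa using hz
      exact this.le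
    rw [norm_mul, norm_pow]
    exact mul_le_one₀ (pow_le_one₀ (norm_nonneg _) hz') (norm_nonneg _) (h1 z hz)

lemma fourier_neg_conj (k : ℕ) (θ : Tc) : fourier (-(k : ℤ)) θ = conj (bd θ ^ k) := by
  rw [fourier_neg, bd_pow]

lemma fc_eq (u : Tc → ℂ) (n : ℤ) : fourierCoeff u n = ∫ θ, fourier (-n) θ * u θ ∂m := by
  unfold fourierCoeff m
  simp

/-- The pair representing the constant function one. -/
lemma const_memLp (c : ℂ) : MemLp (fun _ : Tc => c) 2 m := memLp_const c

def cL (c : ℂ) : L2 := (const_memLp c).toLp _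

lemma cL_ae (c : ℂ) : (cL c : Tc → ℂ) =ᵐ[m] fun _ => c := (const_memLp c).coeFn_toLp

lemma cL_H2 (c : ℂ) : cL c ∈ H2 := by
  intro n hn
  rw [fc_eq]
  have : ∫ θ, fourier (-n) θ * (cL c : Tc → ℂ) θ ∂m = ∫ θ, fourier (-n) θ * c ∂m := by
    apply integral_congr_ae
    filter_upwards [cL_ae c] with θ h
    rw [h]
  rw [this, integral_mul_const]
  obtain ⟨k, rfl⟩ : ∃ k : ℕ, n = -((k : ℤ) + 1) := ⟨(-n - 1).toNat, by omega⟩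
  have h2 := mean_value (g := fun z => 1) (differentiableOn_const _) le_rfl zero_lt_one
  have h3 := bdry_fourier (g := fun z => 1) (G := fun _ => 1) (differentiableOn_const _)
    (Eventually.of_forall fun θ => tendsto_const_nhds) (by simp) (k + 1)
  have h4 : ∫ θ : Tc, fourier (- -((k : ℤ) + 1)) θ ∂m = 0 := by
    rw [← if_neg (Nat.succ_ne_zero k) (α := ℂ) (t := 1) (e := 0)]
    rw [← h3]
    apply integral_congr_ae
    filter_upwards with θ
    rw [neg_neg, mul_one, ← bd_pow]; push_cast; rfl
  rw [h4, zero_mul]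

def oneP (P : BPair) : HbP :=
  (WithLp.equiv 2 (L2 × L2)).symm (cL 1, cL (conj (P.b 0 / P.a 0)))

lemma one_mem (P : BPair) : oneP P ∈ HbSet P := by
  refine ⟨cL_H2 1, cL_H2 _, ?_⟩
  intro n hn
  obtain ⟨k, rfl⟩ := Int.eq_ofNat_of_zero_le hn
  rw [fc_eq]
  set c := P.b 0 / P.a 0 with hc
  have ha := a_le_one P
  have hbi : Integrable (fun θ => bd θ ^ k * P.bs θ) m := by
    refine Integrable.of_bound (C := 1)
      ((bd_continuous.pow k).aestronglyMeasurable.mul (bdry_meas P.b_hol P.b_bdry)) ?_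
    filter_upwards [bdry_le P.b_bdry P.b_le_one] with θ h
    simpa [norm_bd] using h
  have hai : Integrable (fun θ => bd θ ^ k * P.as' θ) m := by
    refine Integrable.of_bound (C := 1)
      ((bd_continuous.pow k).aestronglyMeasurable.mul (bdry_meas P.a_outer.1 P.a_bdry)) ?_
    filter_upwards [bdry_le P.a_bdry ha] with θ h
    simpa [norm_bd] using h
  have e : ∫ θ, fourier (-(k : ℤ)) θ * (conj (P.bs θ) * (fst2 (oneP P) : Tc → ℂ) θ
      - conj (P.as' θ) * (snd2 (oneP P) : Tc → ℂ) θ) ∂m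
      = ∫ θ, conj (bd θ ^ k * P.bs θ - bd θ ^ k * P.as' θ * c) ∂m := by
    apply integral_congr_ae
    have e1 : (fst2 (oneP P) : Tc → ℂ) =ᵐ[m] fun _ => 1 := cL_ae 1
    have e2 : (snd2 (oneP P) : Tc → ℂ) =ᵐ[m] fun _ => conj c := cL_ae (conj c)
    filter_upwards [e1, e2] with θ h1 h2
    rw [h1, h2, fourier_neg_conj]
    simp only [map_sub, map_mul]
    ring
  have hne : P.a 0 ≠ 0 := by
    obtain ⟨r, hr, h⟩ := P.a0_pos
    rw [h]; exact_mod_cast hr.ne'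
  refine e.trans ?_
  rw [integral_conj, integral_sub hbi (hai.mul_const c), integral_mul_const,
    bdry_fourier P.b_hol P.b_bdry P.b_le_one, bdry_fourier P.a_outer.1 P.a_bdry ha]
  split_ifs
  · rw [hc, mul_div_cancel₀ _ hne]; simp
  · simp

lemma span_rep {P : BPair} {lam : ℕ → ℂ} (hlam : ∀ n, lam n ∈ uDisc) {p : HbP} {FK : ℕ → HbP}
    (hFK : KFamily P lam p FK) {q : HbP} (hq : q ∈ Submodule.span ℂ (Set.range FK)) :
    ∃ g : ℂ → ℂ, DiffContOnCl ℂ g uDisc ∧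
      (fst2 q : Tc → ℂ) =ᵐ[m] fun θ => g (bd θ) * (fst2 p : Tc → ℂ) θ := by
  induction hq using Submodule.span_induction with
  | mem x hx =>
    obtain ⟨n, rfl⟩ := hx
    refine ⟨ker (lam n), ?_, (hFK n).2⟩
    apply DifferentiableOn.diffContOnCl
    rw [closure_ball _ one_ne_zero]
    unfold _root_.ker
    refine DifferentiableOn.inv (by fun_prop) ?_
    intro z hz h0
    have h1 : ‖lam n‖ < 1 := by simpa using hlam n
    have h2 : ‖z‖ ≤ 1 := by simpa using hz
    have h3 : conj (lam n) * z = 1 := (sub_eq_zero.1 h0).symm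
    have h4 := congrArg norm h3
    rw [norm_mul, RCLike.norm_conj, norm_one] at h4
    nlinarith [norm_nonneg z, norm_nonneg (lam n)]
  | zero =>
    refine ⟨fun _ => 0, diffContOnCl_const, ?_⟩
    have : (fst2 (0 : HbP) : Tc → ℂ) =ᵐ[m] 0 := Lp.coeFn_zero ℂ 2 m
    filter_upwards [this] with θ h
    simp [h]
  | add x y hx hy h1 h2 =>
    obtain ⟨g, hg, eg⟩ := h1
    obtain ⟨h, hh, eh⟩ := h2
    refine ⟨fun z => g z + h z, hg.add hh, ?_⟩
    have : (fst2 (x + y) : Tc → ℂ) =ᵐ[m] (fst2 x : Tc → ℂ) + (fst2 y : Tc → ℂ) :=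
      Lp.coeFn_add (fst2 x) (fst2 y)
    filter_upwards [this, eg, eh] with θ a1 a2 a3
    rw [a1, Pi.add_apply, a2, a3]; ring
  | smul c x hx h1 =>
    obtain ⟨g, hg, eg⟩ := h1
    refine ⟨fun z => c • g z, hg.const_smul c, ?_⟩
    have : (fst2 (c • x) : Tc → ℂ) =ᵐ[m] c • (fst2 x : Tc → ℂ) :=
      Lp.coeFn_smul c (fst2 x)
    filter_upwards [this, eg] with θ a1 a2
    rw [a1, Pi.smul_apply, a2]; simp [mul_assoc]

lemma L2_int (F : L2) : Integrable (F : Tc → ℂ) m :=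
  (Lp.memLp F).integrable one_le_two

lemma L1_le_L2 (F : L2) : ∫ θ, ‖(F : Tc → ℂ) θ‖ ∂m ≤ ‖F‖ := by
  have h1 := eLpNorm_le_eLpNorm_of_exponent_le (μ := m) (p := 1) (q := 2) one_le_two
    (Lp.aestronglyMeasurable F)
  rw [integral_norm_eq_lintegral_enorm (Lp.aestronglyMeasurable F), Lp.norm_def]
  rw [← eLpNorm_one_eq_lintegral_enorm]
  exact ENNReal.toReal_mono (Lp.eLpNorm_ne_top F) h1

lemma fst2_norm (q : HbP) : ‖fst2 q‖ ≤ ‖q‖ := by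
  have := WithLp.prod_norm_sq_eq_of_L2 q
  have h : ‖fst2 q‖ ^ 2 ≤ ‖q‖ ^ 2 := by
    rw [this]
    have : fst2 q = q.fst := rfl
    rw [this]
    nlinarith [norm_nonneg q.snd]
  exact abs_le_of_sq_le_sq' h (norm_nonneg _) |>.2

lemma approx_one {P : BPair} {lam : ℕ → ℂ} (hlam : ∀ n, lam n ∈ uDisc) {p : HbP} {FK : ℕ → HbP}
    (hFK : KFamily P lam p FK)
    (hcomp : closure (↑(Submodule.span ℂ (Set.range FK)) : Set HbP) = HbSet P)
    {ε : ℝ} (hε : 0 < ε) :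
    ∃ g : ℂ → ℂ, DiffContOnCl ℂ g uDisc ∧
      ∫ θ, ‖(fst2 p : Tc → ℂ) θ * g (bd θ) - 1‖ ∂m ≤ ε := by
  have h1 : oneP P ∈ closure (↑(Submodule.span ℂ (Set.range FK)) : Set HbP) := by
    rw [hcomp]; exact one_mem P
  obtain ⟨q, hq, hd⟩ := Metric.mem_closure_iff.1 h1 ε hε
  obtain ⟨g, hg, eg⟩ := span_rep hlam hFK hq
  refine ⟨g, hg, ?_⟩
  have h2 : ‖fst2 (q - oneP P)‖ ≤ ε := by
    refine (fst2_norm _).trans ?_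
    rw [← dist_eq_norm, dist_comm]; exact hd.le
  refine le_trans (le_of_eq ?_) ((L1_le_L2 _).trans h2)
  apply integral_congr_ae
  have h3 : (fst2 (q - oneP P) : Tc → ℂ) =ᵐ[m] (fst2 q : Tc → ℂ) - (fst2 (oneP P) : Tc → ℂ) :=
    Lp.coeFn_sub (fst2 q) (fst2 (oneP P))
  have e1 : (fst2 (oneP P) : Tc → ℂ) =ᵐ[m] fun _ => 1 := cL_ae 1
  filter_upwards [h3, e1, eg] with θ a1 a2 a3
  rw [a1, Pi.sub_apply, a2, a3, mul_comm]

lemma herglotz_hol {u : Tc → ℝ} (hu : Integrable u m) :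
    HolDisc (fun z => ∫ θ : Tc, ((bd θ + z) / (bd θ - z)) * (u θ : ℂ) ∂m) := by
  intro z hz
  have hz1 : ‖z‖ < 1 := by simpa using hz
  set d : ℝ := (1 - ‖z‖) / 2 with hd
  have hd0 : 0 < d := by rw [hd]; linarith
  have hlow : ∀ x ∈ ball z d, ∀ θ, d ≤ ‖bd θ - x‖ := by
    intro x hx θ
    have h1 : ‖x - z‖ < d := by simpa [dist_eq_norm] using hx
    have h2 : ‖bd θ‖ ≤ ‖bd θ - x‖ + ‖x - z‖ + ‖z‖ := by
      have : bd θ = (bd θ - x) + (x - z) + z := by ring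
      calc ‖bd θ‖ = ‖(bd θ - x) + (x - z) + z‖ := by rw [← this]
        _ ≤ _ := norm_add₃_le
    rw [norm_bd] at h2
    linarith
  have hne : ∀ x ∈ ball z d, ∀ θ, bd θ - x ≠ 0 := by
    intro x hx θ h0
    have := hlow x hx θ
    rw [h0, norm_zero] at this
    linarith
  have hum : AEStronglyMeasurable (fun θ => (u θ : ℂ)) m := hu.ofReal.1
  have hmb : Measurable bd := bd_continuous.measurable
  refine ((hasDerivAt_integral_of_dominated_loc_of_deriv_le
    (F := fun x θ => ((bd θ + x) / (bd θ - x)) * (u θ : ℂ))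
    (F' := fun x θ => (2 * bd θ / (bd θ - x) ^ 2) * (u θ : ℂ))
    (bound := fun θ => 2 * (d ^ 2)⁻¹ * ‖(u θ : ℂ)‖)
    (ball_mem_nhds z hd0) ?meas1 ?int ?meas2 ?bound ?int_bound
    ?diff).2).differentiableAt.differentiableWithinAt
  case meas1 =>
    filter_upwards with x
    exact (Measurable.aestronglyMeasurable (by fun_prop)).mul hum
  case int =>
    obtain ⟨B, hB⟩ := isCompact_univ.exists_bound_of_continuousOn (hk_continuous hz).continuousOn
    refine hu.ofReal.bdd_mul (c := B) (hk_continuous hz).aestronglyMeasurable ?_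
    filter_upwards with θ
    exact hB θ (mem_univ _)
  case meas2 =>
    exact (Measurable.aestronglyMeasurable (by fun_prop)).mul hum
  case bound =>
    filter_upwards with θ x hx
    have h₁ : ‖(2 : ℂ)‖ = 2 := by norm_num
    rw [norm_mul, norm_div, norm_mul, norm_bd, norm_pow, div_eq_mul_inv, h₁, mul_one]
    gcongr
    exact hlow x hx θ
  case int_bound =>
    exact hu.ofReal.norm.const_mul _
  case diff =>
    filter_upwards with θ x hx
    have h₁ := hne x hx θ
    have h₂ : HasDerivAt (fun x => (bd θ + x) / (bd θ - x)) (2 * bd θ / (bd θ - x) ^ 2) x := by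
      have h₃ := ((hasDerivAt_id' x).const_add (bd θ)).div
        ((hasDerivAt_id' x).const_sub (bd θ)) h₁
      exact h₃.congr_deriv (by ring)
    exact h₂.mul_const _

lemma l1_bound {h : ℂ → ℂ} {H : Tc → ℂ} (hh : L1conv h H) {z : ℂ} (hz : z ∈ uDisc) :
    ‖h z‖ ≤ (1 + ‖z‖) / (1 - ‖z‖) * ∫ θ, ‖H θ‖ ∂m := by
  obtain ⟨hd, hH, ht⟩ := hh
  set C := (1 + ‖z‖) / (1 - ‖z‖) with hC
  have hz1 : ‖z‖ < 1 := by simpa using hz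
  have hC0 : 0 ≤ C := div_nonneg (by positivity) (by linarith)
  have key : ∀ n, ‖h (rs n * z)‖ ≤ C * (∫ θ, ‖h (rs n * bd θ) - H θ‖ ∂m + ∫ θ, ‖H θ‖ ∂m) := by
    intro n
    have hc := dil_cont hd (rs_nonneg n) (rs_lt n)
    have hi := cont_int hc
    have i1 : Integrable (fun θ => ‖h (rs n * bd θ) - H θ‖) m := (hi.sub hH).norm
    have i2 : Integrable (fun θ => ‖H θ‖) m := hH.norm
    rw [← integral_add i1 i2, ← poisson_hol (dil_diffcont hd (rs_nonneg n) (rs_lt n)) hz,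
      ← integral_const_mul]
    apply norm_integral_le_of_norm_le ((i1.add i2).const_mul C)
    filter_upwards with θ
    rw [norm_mul, norm_real, Real.norm_of_nonneg (Pk_pos hz θ).le]
    refine mul_le_mul (Pk_le hz θ) ?_ (norm_nonneg _) hC0
    have := norm_add_le (h (rs n * bd θ) - H θ) (H θ)
    simpa using this
  have l1 := (rsz_tendsto hd hz).norm
  have l2 := (ht.add_const (∫ θ, ‖H θ‖ ∂m)).const_mul C
  rw [zero_add] at l2
  exact le_of_tendsto_of_tendsto' l1 l2 key

lemma diffcont_bound {g : ℂ → ℂ} (hg : DiffContOnCl ℂ g uDisc) :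
    ∃ B : ℝ, 0 ≤ B ∧ ∀ z ∈ closedBall (0 : ℂ) 1, ‖g z‖ ≤ B := by
  have hc := hg.continuousOn
  rw [closure_ball _ one_ne_zero] at hc
  obtain ⟨B, hB⟩ := (isCompact_closedBall (0 : ℂ) 1).exists_bound_of_continuousOn hc
  exact ⟨B, (norm_nonneg _).trans (hB 0 (by simp)), hB⟩

lemma diffcont_bd_cont {g : ℂ → ℂ} (hg : DiffContOnCl ℂ g uDisc) :
    Continuous fun θ => g (bd θ) := by
  have hc := hg.continuousOn
  rw [closure_ball _ one_ne_zero] at hc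
  exact hc.comp_continuous bd_continuous fun θ => sphere_subset_closedBall (bd_mem θ)

lemma diffcont_bdry {g : ℂ → ℂ} (hg : DiffContOnCl ℂ g uDisc) :
    IsBdry g (fun θ => g (bd θ)) := by
  have hc := hg.continuousOn
  rw [closure_ball _ one_ne_zero] at hc
  filter_upwards with θ
  have h1 := hc (bd θ) (sphere_subset_closedBall (bd_mem θ))
  refine h1.tendsto.comp (tendsto_nhdsWithin_iff.2 ⟨?_, ?_⟩)
  · have c : Continuous fun r : ℝ => (r : ℂ) * bd θ := by fun_prop
    have := (c.tendsto 1).mono_left (nhdsWithin_le_nhds (s := Iio 1))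
    simpa using this
  · have h0 : Ioo (0 : ℝ) 1 ∈ nhdsWithin (1 : ℝ) (Iio 1) := Ioo_mem_nhdsLT zero_lt_one
    filter_upwards [h0] with r hr
    exact ball_subset_closedBall (rbd_mem hr.1.le hr.2 θ)

lemma l1conv_diffcont {g : ℂ → ℂ} (hg : DiffContOnCl ℂ g uDisc) :
    L1conv g (fun θ => g (bd θ)) := by
  obtain ⟨B, hB0, hB⟩ := diffcont_bound hg
  refine l1conv_of ⟨hg.differentiableOn, B ^ (2 : ℝ), ?_⟩ (cont_int (diffcont_bd_cont hg))
    (diffcont_bdry hg)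
  intro r h0 h1
  have hc : Continuous fun θ => ‖g (r * bd θ)‖ ^ (2 : ℝ) :=
    (dil_cont hg.differentiableOn h0 h1).norm.rpow_const fun _ => Or.inr (by norm_num)
  calc ∫ θ, ‖g (r * bd θ)‖ ^ (2 : ℝ) ∂m ≤ ∫ θ : Tc, B ^ (2 : ℝ) ∂m := by
        apply integral_mono (cont_int hc) (integrable_const _)
        intro θ
        exact Real.rpow_le_rpow (norm_nonneg _)
          (hB _ (ball_subset_closedBall (rbd_mem h0 h1 θ))) (by norm_num)
    _ = B ^ (2 : ℝ) := by simp

lemma l1conv_prod {f g : ℂ → ℂ} {F : Tc → ℂ} (hf : MemHp 2 f) (hF : Integrable F m)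
    (hb : IsBdry f F) (hg : DiffContOnCl ℂ g uDisc) :
    L1conv (fun z => f z * g z - 1) (fun θ => F θ * g (bd θ) - 1) := by
  obtain ⟨B, hB0, hB⟩ := diffcont_bound hg
  obtain ⟨hd, C, hC⟩ := hf
  have hdf : HolDisc (fun z => f z * g z - 1) :=
    (DifferentiableOn.mul hd hg.differentiableOn).sub (differentiableOn_const _)
  have hFg : Integrable (fun θ => F θ * g (bd θ) - 1) m := by
    have : Integrable (fun θ => F θ * g (bd θ)) m := by
      refine hF.mul_bdd (c := B) (diffcont_bd_cont hg).aestronglyMeasurable ?_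
      filter_upwards with θ
      exact hB _ (sphere_subset_closedBall (bd_mem θ))
    exact this.sub (integrable_const _)
  refine l1conv_of ⟨hdf, 2 * B ^ 2 * C + 2, ?_⟩ hFg ?_
  · intro r h0 h1
    have hc1 := dil_cont hd h0 h1
    have hc2 := dil_cont hdf h0 h1
    have hr := hC r h0 h1
    simp only [Real.rpow_two] at hr ⊢
    have i1 : Integrable (fun θ => 2 * B ^ 2 * ‖f (r * bd θ)‖ ^ 2) m :=
      cont_int (continuous_const.mul (hc1.norm.pow 2))
    have i2 : Integrable (fun θ => 2 * B ^ 2 * ‖f (r * bd θ)‖ ^ 2 + 2) m :=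
      i1.add (integrable_const _)
    calc ∫ θ, ‖f (r * bd θ) * g (r * bd θ) - 1‖ ^ 2 ∂m
        ≤ ∫ θ, (2 * B ^ 2 * ‖f (r * bd θ)‖ ^ 2 + 2) ∂m := by
          apply integral_mono (cont_int (hc2.norm.pow 2)) i2
          intro θ
          have h2 := hB _ (ball_subset_closedBall (rbd_mem h0 h1 θ))
          have h3 : ‖f (r * bd θ) * g (r * bd θ) - 1‖ ≤ ‖f (r * bd θ)‖ * B + 1 := by
            refine (norm_sub_le _ _).trans ?_
            rw [norm_mul, norm_one]
            gcongr
          have h4 := pow_le_pow_left₀ (norm_nonneg _) h3 2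
          refine h4.trans ?_
          nlinarith [sq_nonneg (‖f (r * bd θ)‖ * B - 1)]
      _ = 2 * B ^ 2 * ∫ θ, ‖f (r * bd θ)‖ ^ 2 ∂m + 2 := by
          rw [integral_add i1 (integrable_const _), integral_const_mul]; simp
      _ ≤ 2 * B ^ 2 * C + 2 := by gcongr
  · filter_upwards [hb, diffcont_bdry hg] with θ h1 h2
    exact (h1.mul h2).sub_const 1

lemma log_eq {f : ℂ → ℂ} {F : Tc → ℂ} (hf : MemHp 2 f) (hF : Integrable F m)
    (hb : IsBdry f F)
    (happ : ∀ ε : ℝ, 0 < ε → ∃ g : ℂ → ℂ, DiffContOnCl ℂ g uDisc ∧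
      ∫ θ, ‖F θ * g (bd θ) - 1‖ ∂m ≤ ε) {z : ℂ} (hz : z ∈ uDisc) :
    f z ≠ 0 ∧ Real.log ‖f z‖ = PI (fun θ => Real.log ‖F θ‖) z := by
  have hf1 := l1conv_of hf hF hb
  set C := (1 + ‖z‖) / (1 - ‖z‖) with hC
  have hz1 : ‖z‖ < 1 := by simpa using hz
  have hC0 : 0 < C := div_pos (by positivity) (by linarith)
  have key : ∀ t : ℝ, 0 < t → t < 1 → f z ≠ 0 ∧
      PI (fun θ => Real.log ‖F θ‖) z + (Real.log (1 - t) - t) ≤ Real.log ‖f z‖ := by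
    intro t ht0 ht1
    obtain ⟨g, hg, hgi⟩ := happ (t / C) (div_pos ht0 hC0)
    have hp := l1conv_prod hf hF hb hg
    have h1 : ‖f z * g z - 1‖ ≤ t := by
      refine (l1_bound hp hz).trans ?_
      calc C * ∫ θ, ‖F θ * g (bd θ) - 1‖ ∂m ≤ C * (t / C) := by gcongr
        _ = t := by field_simp
    have h2 : 1 - t ≤ ‖f z‖ * ‖g z‖ := by
      rw [← norm_mul]
      have := norm_sub_norm_le (1 : ℂ) (f z * g z)
      rw [norm_one, norm_sub_rev] at this
      linarith
    have hpos : 0 < ‖f z‖ * ‖g z‖ := by linarith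
    have hfz : f z ≠ 0 := by
      intro h0; rw [h0, norm_zero, zero_mul] at hpos; exact lt_irrefl _ hpos
    have hgz : g z ≠ 0 := by
      intro h0; rw [h0, norm_zero, mul_zero] at hpos; exact lt_irrefl _ hpos
    refine ⟨hfz, ?_⟩
    obtain ⟨f1, f2, f3⟩ := jensen hf1 hz hfz
    obtain ⟨g1, g2, g3⟩ := jensen (l1conv_diffcont hg) hz hgz
    have h3 : Real.log (1 - t) ≤ Real.log ‖f z‖ + Real.log ‖g z‖ := by
      rw [← Real.log_mul (norm_ne_zero_iff.2 hfz) (norm_ne_zero_iff.2 hgz)]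
      exact Real.log_le_log (by linarith) h2
    have h4 : PI (fun θ => Real.log ‖F θ‖) z + ∫ θ, Pk z θ * Real.log ‖g (bd θ)‖ ∂m ≤ t := by
      unfold PI
      rw [← integral_add (Pk_mul_int hz f2) (Pk_mul_int hz g2)]
      have hni : Integrable (fun θ => ‖F θ * g (bd θ) - 1‖) m := hp.2.1.norm
      calc ∫ θ, (Pk z θ * Real.log ‖F θ‖ + Pk z θ * Real.log ‖g (bd θ)‖) ∂m
          ≤ ∫ θ, C * ‖F θ * g (bd θ) - 1‖ ∂m := by
            apply integral_mono_ae ((Pk_mul_int hz f2).add (Pk_mul_int hz g2)) (hni.const_mul C)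
            filter_upwards [f1, g1] with θ a1 a2
            have a3 : Real.log ‖F θ‖ + Real.log ‖g (bd θ)‖ ≤ ‖F θ * g (bd θ) - 1‖ := by
              rw [← Real.log_mul (norm_ne_zero_iff.2 a1) (norm_ne_zero_iff.2 a2), ← norm_mul]
              have b1 := Real.log_le_sub_one_of_pos (norm_pos_iff.2 (mul_ne_zero a1 a2))
              have b2 := norm_sub_norm_le (F θ * g (bd θ)) 1
              rw [norm_one] at b2
              linarith
            have a4 : Pk z θ * ‖F θ * g (bd θ) - 1‖ ≤ C * ‖F θ * g (bd θ) - 1‖ :=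
              mul_le_mul_of_nonneg_right (Pk_le hz θ) (norm_nonneg _)
            have a5 := mul_le_mul_of_nonneg_left a3 (Pk_pos hz θ).le
            simp only [Pi.add_apply]
            linarith
        _ = C * ∫ θ, ‖F θ * g (bd θ) - 1‖ ∂m := integral_const_mul _ _
        _ ≤ C * (t / C) := by gcongr
        _ = t := by field_simp
    linarith
  have hfz := (key (1 / 2) (by norm_num) (by norm_num)).1
  refine ⟨hfz, le_antisymm (jensen hf1 hz hfz).2.2 ?_⟩
  have hl : Tendsto (fun t : ℝ => PI (fun θ => Real.log ‖F θ‖) z + (Real.log (1 - t) - t))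
      (nhdsWithin 0 (Ioi 0)) (nhds (PI (fun θ => Real.log ‖F θ‖) z)) := by
    have c : ContinuousAt (fun t : ℝ =>
        PI (fun θ => Real.log ‖F θ‖) z + (Real.log (1 - t) - t)) 0 := by
      refine continuousAt_const.add (ContinuousAt.sub (ContinuousAt.log ?_ ?_) continuousAt_id)
      · fun_prop
      · norm_num
    have := c.tendsto.mono_left (nhdsWithin_le_nhds (s := Ioi 0))
    simpa using this
  refine le_of_tendsto hl ?_
  filter_upwards [Ioo_mem_nhdsGT zero_lt_one] with t ht
  exact (key t ht.1 ht.2).2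

lemma outer_of {f : ℂ → ℂ} {F : Tc → ℂ} (hf : MemHp 2 f) (hF : Integrable F m)
    (hb : IsBdry f F)
    (happ : ∀ ε : ℝ, 0 < ε → ∃ g : ℂ → ℂ, DiffContOnCl ℂ g uDisc ∧
      ∫ θ, ‖F θ * g (bd θ) - 1‖ ∂m ≤ ε) : OuterFn f := by
  have hlog := fun z (hz : z ∈ uDisc) => log_eq hf hF hb happ hz
  have h0 : (0 : ℂ) ∈ uDisc := by simp
  have hlogint := (jensen (l1conv_of hf hF hb) h0 (hlog 0 h0).1).2.1
  set S : ℂ → ℂ := fun z => ∫ θ : Tc, ((bd θ + z) / (bd θ - z)) * (Real.log ‖F θ‖ : ℂ) ∂m with hS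
  have hSh : HolDisc S := herglotz_hol hlogint
  set q : ℂ → ℂ := fun z => f z * Complex.exp (-S z) with hq
  have hqd : DifferentiableOn ℂ q uDisc :=
    DifferentiableOn.mul hf.1 (DifferentiableOn.cexp (DifferentiableOn.neg hSh))
  have hqn : ∀ z ∈ uDisc, ‖q z‖ = 1 := by
    intro z hz
    obtain ⟨h1, h2⟩ := hlog z hz
    rw [hq]
    simp only
    rw [norm_mul, Complex.norm_exp, neg_re, hS, herglotz_re hlogint hz, ← h2, Real.exp_neg,
      Real.exp_log (norm_pos_iff.2 h1), mul_inv_cancel₀ (norm_ne_zero_iff.2 h1)]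
  have hconst := Complex.eqOn_of_isPreconnected_of_isMaxOn_norm
    (convex_ball (0 : ℂ) 1).isPreconnected isOpen_ball hqd h0
    (fun z hz => by simp [hqn z hz, hqn 0 h0])
  refine ⟨hf.1, q 0, fun θ => ‖F θ‖, hqn 0 h0, fun _ => norm_nonneg _, hlogint, ?_⟩
  intro z hz
  have h3 : q z = q 0 := hconst hz
  rw [← h3]
  change f z = f z * Complex.exp (-S z) * Complex.exp (S z)
  rw [mul_assoc, ← Complex.exp_add, neg_add_cancel, Complex.exp_zero, mul_one]

/-- Let `(λ_n) ⊂ 𝔻` with `Σ (1 - |λ_n|) = ∞` and `f ∈ H(b)`. If the closed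
linear span in `H(b)` of `{f·k_{λ_n}}` equals `H(b)`, then `f` is outer. -/
theorem stmt_9 (P : BPair) (lam : ℕ → ℂ) (hlam : ∀ n, lam n ∈ uDisc) (hBl : NotBlaschke lam)
    (f : ℂ → ℂ) (p : HbP) (hp : p ∈ HbSet P) (hf2 : MemHp 2 f)
    (hbd : IsBdry f (fst2 p : Tc → ℂ))
    (FK : ℕ → HbP) (hFK : KFamily P lam p FK)
    (hcomp : closure (↑(Submodule.span ℂ (Set.range FK)) : Set HbP) = HbSet P) :
    OuterFn f := by
  exact outer_of hf2 (L2_int (fst2 p)) hbd fun ε hε => approx_one hlam hFK hcomp hε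

end
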